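/- Let d ≥ 1 be an integer and P ⊆ ℤ. Then P is intersective of order d if and only if P is a Poincaré recurrence set of order d, where P is intersective of order d means: for every set F ⊆ ℤ with positive upper Banach density there exist n_1,…,n_d ∈ ℤ with FS({n_i}_{i=1}^d) ⊆ P and an a ∈ F with a + FS({n_i}_{i=1}^d) ⊆ F (equivalently, F ∩ ⋂_{n ∈ FS({n_i}_{i=1}^d)} (F − n) ≠ ∅). -/

import Mathlib

open scoped Classical
open MeasureTheory Filter Topology

noncomputable section

/-- Integer iterate of a bijection `T` of a set: `zIter T n = T^n`. -/
def zIter {X : Type*} (T : Equiv.Perm X) (n : ℤ) : X → X := ⇑(T ^ n)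

/-- Integer iterate of a homeomorphism. -/
def hIter {X : Type*} [TopologicalSpace X] (T : X ≃ₜ X) (n : ℤ) : X → X :=
  zIter T.toEquiv n

/-- The integer nearest to `a`, with ties broken towards the smaller integer.
This is the `⌈·⌉` of the paper. -/
def nearInt (a : ℝ) : ℤ := if a - (⌊a⌋ : ℝ) ≤ 1/2 then ⌊a⌋ else ⌈a⌉

/-- The distance from `a` to the nearest integer, i.e. `‖a‖` in the paper. -/
def distInt (a : ℝ) : ℝ := |a - (nearInt a : ℝ)|

/-- Generalized polynomials of degree at most `d` (for `d ≥ 1`):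
`GP 1` is the smallest collection of functions `ℤ → ℝ` containing `n ↦ a n`
and closed under taking the nearest integer, scalar multiplication and finite sums;
`GP d` moreover contains every `GP e` for `e < d` and all functions
`n ↦ a₀ n^{p₀} ⌈f₁(n)⌉ ⋯ ⌈f k (n)⌉` with `f l ∈ GP (p l)` and `p₀ + ∑ p l = d`. -/
inductive GP : ℕ → (ℤ → ℝ) → Prop
  | lin (a : ℝ) : GP 1 (fun n => a * n)
  | mono {d : ℕ} (hd : 1 ≤ d) (a₀ : ℝ) (p₀ : ℕ) {k : ℕ} (p : Fin k → ℕ)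
      (f : Fin k → ℤ → ℝ) (hf : ∀ l, GP (p l) (f l)) (hsum : p₀ + ∑ l, p l = d) :
      GP d (fun n => a₀ * (n : ℝ) ^ p₀ * ∏ l, (nearInt (f l n) : ℝ))
  | incl {d e : ℕ} (hed : e < d) {f : ℤ → ℝ} (hf : GP e f) : GP d f
  | ceil {d : ℕ} {f : ℤ → ℝ} (hf : GP d f) : GP d (fun n => (nearInt (f n) : ℝ))
  | smul {d : ℕ} (c : ℝ) {f : ℤ → ℝ} (hf : GP d f) : GP d (fun n => c * f n)
  | add {d : ℕ} {f g : ℤ → ℝ} (hf : GP d f) (hg : GP d g) : GP d (fun n => f n + g n)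

/-- The bracket expression `L(a₁, …, a_ℓ) = a₁⌈L(a₂, …, a_ℓ)⌉`, `L(a) = a`. -/
def Lfun : List ℝ → ℝ
  | [] => 0
  | [a] => a
  | a :: b :: rest => a * (nearInt (Lfun (b :: rest)) : ℝ)

/-- Special generalized polynomials of degree at most `d`:
the functions `n ↦ L(n^{j₁} a₁, …, n^{j_ℓ} a_ℓ)` with `1 ≤ ℓ`, `j t ≥ 1`, `∑ j t ≤ d`. -/
def SGP (d : ℕ) (g : ℤ → ℝ) : Prop :=
  ∃ ℓ : ℕ, 1 ≤ ℓ ∧ ∃ (a : Fin ℓ → ℝ) (j : Fin ℓ → ℕ),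
    (∀ t, 1 ≤ j t) ∧ (∑ t, j t) ≤ d ∧
    g = fun n : ℤ => Lfun (List.ofFn fun t => (n : ℝ) ^ (j t) * a t)

/-- `FS({n i}) = {n_{i₁} + ⋯ + n_{i_k} : i₁ < ⋯ < i_k}`, the set of finite sums. -/
def FS {d : ℕ} (n : Fin d → ℤ) : Set ℤ :=
  { m | ∃ I : Finset (Fin d), I.Nonempty ∧ m = ∑ i ∈ I, n i }

/-- `SG d P`: sums `p_{i₁} + ⋯ + p_{i_k}` over strictly increasing finite index
sequences whose consecutive gaps are at most `d` (infinite sequence `P`). -/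
def SG (d : ℕ) (P : ℕ → ℤ) : Set ℤ :=
  { n | ∃ k : ℕ, ∃ i : Fin (k + 1) → ℕ, StrictMono i ∧
      (∀ t : Fin k, i t.succ - i t.castSucc ≤ d) ∧ n = ∑ t, P (i t) }

/-- `SGfin d P` : the same for a finite sequence `P` of length `m`. -/
def SGfin (d : ℕ) {m : ℕ} (P : Fin m → ℤ) : Set ℤ :=
  { n | ∃ k : ℕ, ∃ i : Fin (k + 1) → Fin m, StrictMono i ∧
      (∀ t : Fin k, (i t.succ : ℕ) - (i t.castSucc : ℕ) ≤ d) ∧ n = ∑ t, P (i t) }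

/-- A set of integers is syndetic if it has bounded gaps. -/
def Syndetic (A : Set ℤ) : Prop :=
  ∃ N : ℕ, ∀ i : ℤ, ∃ j, i ≤ j ∧ j ≤ i + N ∧ j ∈ A

/-- `F` has positive upper Banach density. -/
def PosUpperBanachDensity (F : Set ℤ) : Prop :=
  ∃ δ : ℝ, 0 < δ ∧ ∀ N : ℕ, ∃ (a : ℤ) (L : ℕ), N ≤ L ∧ 1 ≤ L ∧
    δ * L ≤ ((Finset.Icc a (a + L - 1)).filter (fun x => x ∈ F)).card

/-- A set `A ⊆ ℤ` contains finite IP-sets of arbitrarily long lengths. -/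
def ContainsArbLongFIP (A : Set ℤ) : Prop :=
  ∀ k : ℕ, 1 ≤ k → ∃ p : Fin k → ℤ, FS p ⊆ A

/-- A topological dynamical system `(X, T)` is minimal: every orbit is dense. -/
def MinimalTDS {X : Type*} [TopologicalSpace X] (T : X ≃ₜ X) : Prop :=
  ∀ x : X, Dense (Set.range fun n : ℤ => hIter T n x)

/-- `Nset T x U = N(x, U) = {n ∈ ℤ : Tⁿ x ∈ U}`. -/
def Nset {X : Type*} [TopologicalSpace X] (T : X ≃ₜ X) (x : X) (U : Set X) : Set ℤ :=
  { n : ℤ | hIter T n x ∈ U }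

/-- The regionally proximal relation of order `d`. -/
def RPd {X : Type*} [MetricSpace X] (T : X ≃ₜ X) (d : ℕ) (x y : X) : Prop :=
  ∀ δ : ℝ, 0 < δ → ∃ (x' y' : X) (n : Fin d → ℤ),
    dist x x' < δ ∧ dist y y' < δ ∧
    ∀ ε : Finset (Fin d), ε.Nonempty →
      dist (hIter T (∑ i ∈ ε, n i) x') (hIter T (∑ i ∈ ε, n i) y') < δ

/-- `S` is a set of `d`-topological recurrence. -/
def TopRecSet (d : ℕ) (S : Set ℤ) : Prop :=
  ∀ (X : Type) [MetricSpace X] [CompactSpace X] (T : X ≃ₜ X), MinimalTDS T →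
    ∀ U : Set X, IsOpen U → U.Nonempty →
      ∃ n ∈ S, (⋂ j ∈ Finset.range (d + 1), hIter T ((j : ℤ) * n) ⁻¹' U).Nonempty

/-- `S` is a set of `d`-recurrence (measurable recurrence). -/
def MeasRecSet (d : ℕ) (S : Set ℤ) : Prop :=
  ∀ (Y : Type) [MeasurableSpace Y] [StandardBorelSpace Y]
    (μ : Measure Y) [IsProbabilityMeasure μ] (T : Y ≃ᵐ Y),
    MeasurePreserving (⇑T) μ μ →
    ∀ A : Set Y, MeasurableSet A → 0 < μ A →
      ∃ n ∈ S, 0 < μ (⋂ j ∈ Finset.range (d + 1), zIter T.toEquiv ((j : ℤ) * n) ⁻¹' A)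

/-- `P` is a Birkhoff recurrence set of order `d`. -/
def BirkhoffRecSet (d : ℕ) (P : Set ℤ) : Prop :=
  ∀ (X : Type) [MetricSpace X] [CompactSpace X] (T : X ≃ₜ X), MinimalTDS T →
    ∀ U : Set X, IsOpen U → U.Nonempty →
      ∃ n : Fin d → ℤ, FS n ⊆ P ∧ (U ∩ ⋂ m ∈ FS n, hIter T m ⁻¹' U).Nonempty

/-- `F` is a Poincaré recurrence set of order `d`. -/
def PoincareRecSet (d : ℕ) (F : Set ℤ) : Prop :=
  ∀ (Y : Type) [MeasurableSpace Y] [StandardBorelSpace Y]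
    (μ : Measure Y) [IsProbabilityMeasure μ] (T : Y ≃ᵐ Y),
    MeasurePreserving (⇑T) μ μ →
    ∀ A : Set Y, MeasurableSet A → 0 < μ A →
      ∃ n : Fin d → ℤ, FS n ⊆ F ∧ 0 < μ (A ∩ ⋂ m ∈ FS n, zIter T.toEquiv m ⁻¹' A)

/-- The upper unitriangular matrix `M(a)` with entries `(M(a))_{i, i+k} = a i k`
(1-based indexing). -/
def Mmat (d : ℕ) (a : ℕ → ℕ → ℝ) : Matrix (Fin (d + 1)) (Fin (d + 1)) ℝ :=
  fun r c =>
    if (r : ℕ) = (c : ℕ) then 1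
    else if (r : ℕ) < (c : ℕ) then a ((r : ℕ) + 1) ((c : ℕ) - (r : ℕ)) else 0

/-- `P_ℓ(a; i, k) = ∑ a_i^{s₁} a_{i+s₁}^{s₂} ⋯`, sum over `(s₁,…,s_ℓ) ∈ {1,…,k}^ℓ`
with `s₁ + ⋯ + s_ℓ = k`. -/
def Ppoly (a : ℕ → ℕ → ℝ) (i k ℓ : ℕ) : ℝ :=
  ∑ s ∈ Finset.univ.filter (fun s : Fin ℓ → Fin k => (∑ t, ((s t : ℕ) + 1)) = k),
    ∏ t : Fin ℓ,
      a (i + ∑ u ∈ Finset.univ.filter (fun u : Fin ℓ => u < t), ((s u : ℕ) + 1))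
        ((s t : ℕ) + 1)

/-- The upper unitriangular matrix with superdiagonal `α₁, …, α_d` (1-based). -/
def Amat (d : ℕ) (α : ℕ → ℝ) : Matrix (Fin (d + 1)) (Fin (d + 1)) ℝ :=
  fun r c =>
    if (r : ℕ) = (c : ℕ) then 1
    else if (c : ℕ) = (r : ℕ) + 1 then α ((r : ℕ) + 1) else 0

end

lemma zIter_add {X : Type*} (T : Equiv.Perm X) (a b : ℤ) (x : X) :
    zIter T (a + b) x = zIter T a (zIter T b x) := by
  simp [zIter, zpow_add]

lemma zIter_nat {X : Type*} (T : Equiv.Perm X) (a : ℕ) : zIter T (a : ℤ) = T^[a] := by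
  rw [zIter, zpow_natCast, Equiv.Perm.coe_pow]

lemma zIter_measurable {X : Type*} [MeasurableSpace X] (T : X ≃ᵐ X) (n : ℤ) :
    Measurable (zIter T.toEquiv n) := by
  obtain ⟨k, rfl | rfl⟩ := n.eq_nat_or_neg
  · rw [zIter_nat]; exact T.measurable.iterate k
  · have : zIter T.toEquiv (-(k : ℤ)) = T.symm^[k] := by
      simp only [zIter, zpow_neg, zpow_natCast, ← inv_pow, Equiv.Perm.coe_pow]
      rfl
    rw [this]; exact T.symm.measurable.iterate k

lemma FS_finite {d : ℕ} (n : Fin d → ℤ) : (FS n).Finite := by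
  refine (Set.finite_range (fun I : Finset (Fin d) => ∑ i ∈ I, n i)).subset ?_
  rintro m ⟨I, -, rfl⟩
  exact ⟨I, rfl⟩

lemma exists_dense_return {Y : Type} [MeasurableSpace Y]
    (μ : Measure Y) [IsProbabilityMeasure μ] (T : Y ≃ᵐ Y)
    (hT : MeasurePreserving (⇑T) μ μ) (A : Set Y) (hA : MeasurableSet A) (h0 : 0 < μ A) :
    ∃ x, PosUpperBanachDensity {n : ℤ | zIter T.toEquiv n x ∈ A} := by
  set f : ℕ → Y → ENNReal := fun N x =>
    (∑ i ∈ Finset.range (N + 1), A.indicator 1 (T^[i] x)) * ((N + 1 : ℕ) : ENNReal)⁻¹ with hf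
  have hm : ∀ i : ℕ, Measurable fun x => A.indicator (1 : Y → ENNReal) (T^[i] x) := fun i =>
    (measurable_one.indicator hA).comp (T.measurable.iterate i)
  have hfm : ∀ N, Measurable (f N) := fun N =>
    (Finset.measurable_fun_sum _ fun i _ => hm i).mul_const _
  have hfi : ∀ N, ∫⁻ x, f N x ∂μ = μ A := by
    intro N
    simp only [hf]
    rw [lintegral_mul_const _ (Finset.measurable_fun_sum _ fun i _ => hm i),
      lintegral_finset_sum _ (fun i _ => hm i)]
    have : ∀ i ∈ Finset.range (N + 1), ∫⁻ x, A.indicator (1 : Y → ENNReal) (T^[i] x) ∂μ = μ A := by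
      intro i _
      rw [(hT.iterate i).lintegral_comp (measurable_one.indicator hA), lintegral_indicator_one hA]
    rw [Finset.sum_congr rfl this, Finset.sum_const, Finset.card_range, nsmul_eq_mul, mul_right_comm,
      ENNReal.mul_inv_cancel (by simp) (by simp), one_mul]
  have hsum : ∀ N x, (∑ i ∈ Finset.range (N + 1), A.indicator (1 : Y → ENNReal) (T^[i] x))
      = (((Finset.range (N + 1)).filter (fun i => T^[i] x ∈ A)).card : ENNReal) := by
    intro N x
    rw [Finset.card_filter]; push_cast
    refine Finset.sum_congr rfl fun i _ => ?_
    by_cases h : T^[i] x ∈ A <;> simp [h]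
  have hle : ∀ N x, f N x ≤ 1 := by
    intro N x
    simp only [hf, hsum]
    rw [← div_eq_mul_inv]
    refine ENNReal.div_le_of_le_mul ?_
    rw [one_mul]
    exact_mod_cast (Finset.card_filter_le _ _).trans (by simp)
  have hx : ∃ x, μ A / 2 < limsup (fun N => f N x) atTop := by
    by_contra! hcon
    have h1 := limsup_lintegral_le (μ := μ) (f := f) (fun _ => 1) hfm
      (fun N => ae_of_all _ (hle N)) (by simp)
    simp only [hfi, limsup_const] at h1
    have h2 : ∫⁻ x, limsup (fun N => f N x) atTop ∂μ ≤ ∫⁻ x, μ A / 2 ∂μ := lintegral_mono hcon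
    simp only [lintegral_const, measure_univ, mul_one] at h2
    exact absurd (h1.trans h2) (not_le.2 (ENNReal.half_lt_self h0.ne' (measure_ne_top _ _)))
  obtain ⟨x, hx⟩ := hx
  refine ⟨x, (μ A / 2).toReal, ENNReal.toReal_pos (by simp [h0.ne'])
    (ENNReal.div_ne_top (measure_ne_top _ _) (by simp)), fun N => ?_⟩
  have hfr := frequently_lt_of_lt_limsup (by isBoundedDefault) hx
  obtain ⟨M, hM, hMN⟩ := (hfr.and_eventually (eventually_ge_atTop N)).exists
  refine ⟨0, M + 1, by omega, by omega, ?_⟩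
  simp only [hf, hsum] at hM
  rw [← div_eq_mul_inv, ENNReal.lt_div_iff_mul_lt (by simp) (by simp)] at hM
  have h3 := ENNReal.toReal_mono (by simp) hM.le
  rw [ENNReal.toReal_mul, ENNReal.toReal_natCast, ENNReal.toReal_natCast] at h3
  refine h3.trans ?_
  refine Nat.cast_le.2 ?_
  refine Finset.card_le_card_of_injOn (fun i : ℕ => (i : ℤ)) ?_ (fun a _ b _ h => by simpa using h)
  intro i hi
  simp only [Finset.coe_filter, Finset.mem_range, Set.mem_setOf_eq] at hi
  simp only [Finset.coe_filter, Finset.mem_Icc, Set.mem_setOf_eq, zIter_nat]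
  refine ⟨⟨by positivity, by push_cast; omega⟩, hi.2⟩

lemma forward_dir (d : ℕ) (P : Set ℤ)
    (h : ∀ F : Set ℤ, PosUpperBanachDensity F →
        ∃ n : Fin d → ℤ, FS n ⊆ P ∧ ∃ a ∈ F, ∀ m ∈ FS n, a + m ∈ F) : PoincareRecSet d P := by
  intro Y _ _ μ _ T hT A hA h0
  set bad : (Fin d → ℤ) → Set Y := fun n => A ∩ ⋂ m ∈ FS n, zIter T.toEquiv m ⁻¹' A with hbad
  have hbm : ∀ n, MeasurableSet (bad n) := fun n =>
    hA.inter (MeasurableSet.biInter (FS_finite n).countable fun m _ => zIter_measurable T m hA)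
  set B : Set Y := ⋃ n ∈ {n | μ (bad n) = 0}, bad n with hB
  have hBm : MeasurableSet B := MeasurableSet.biUnion (Set.to_countable _) fun n _ => hbm n
  have hB0 : μ B = 0 := (measure_biUnion_null_iff (Set.to_countable _)).2 fun n hn => hn
  obtain ⟨x, hx⟩ := exists_dense_return μ T hT (A \ B) (hA.diff hBm)
    (by rwa [measure_diff_null hB0])
  obtain ⟨n, hn, a, ha, ham⟩ := h _ hx
  refine ⟨n, hn, ?_⟩
  rw [pos_iff_ne_zero]
  intro hz
  refine ha.2 ?_
  refine Set.mem_biUnion (x := n) hz ⟨ha.1, ?_⟩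
  refine Set.mem_iInter₂.2 fun m hm => ?_
  have := (ham m hm).1
  rwa [add_comm, zIter_add] at this

/-- The shift. -/
def shiftE : (ℤ → Bool) ≃ᵐ (ℤ → Bool) where
  toFun x k := x (k + 1)
  invFun x k := x (k - 1)
  left_inv x := by funext k; simp
  right_inv x := by funext k; simp
  measurable_toFun := measurable_pi_lambda _ fun k => measurable_pi_apply _
  measurable_invFun := measurable_pi_lambda _ fun k => measurable_pi_apply _

lemma shiftE_iter (m : ℤ) (x : ℤ → Bool) : zIter shiftE.toEquiv m x = fun k => x (k + m) := by
  induction m using Int.induction_on generalizing x with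
  | zero => simp [zIter]
  | succ i ih =>
    rw [zIter_add, ih]
    funext k
    simp only [zIter, zpow_one]
    change x (k + i + 1) = _
    congr 1; ring
  | pred i ih =>
    rw [sub_eq_add_neg, zIter_add, ih]
    funext k
    simp only [zIter, zpow_neg, zpow_one]
    change x (k + -i - 1) = _
    congr 1; ring

/-- The orbit of the indicator of `F`. -/
noncomputable def orb (F : Set ℤ) (n : ℤ) : ℤ → Bool := fun k => decide (n + k ∈ F)

/-- Empirical measure. -/
noncomputable def emp (F : Set ℤ) (a : ℤ) (L : ℕ) : Measure (ℤ → Bool) :=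
  ∑ i ∈ Finset.range L, (L : ENNReal)⁻¹ • Measure.dirac (orb F (a + i))

lemma emp_apply (F : Set ℤ) (a : ℤ) (L : ℕ) {B : Set (ℤ → Bool)} (hB : MeasurableSet B) :
    emp F a L B = (L : ENNReal)⁻¹ *
      (((Finset.range L).filter fun i : ℕ => orb F (a + i) ∈ B).card : ENNReal) := by
  rw [emp, Measure.finset_sum_apply, Finset.card_filter]
  push_cast
  rw [Finset.mul_sum]
  refine Finset.sum_congr rfl fun i _ => ?_
  by_cases h : orb F (a + i) ∈ B <;> simp [hB, h]

lemma emp_pos (F : Set ℤ) (a : ℤ) (L : ℕ) {B : Set (ℤ → Bool)} (hB : MeasurableSet B)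
    (hN : 0 < emp F a L B) : ∃ i : ℕ, orb F (a + i) ∈ B := by
  rw [emp_apply _ _ _ hB] at hN
  have hc := Nat.cast_ne_zero.1 (right_ne_zero_of_mul hN.ne')
  obtain ⟨i, hi⟩ := Finset.card_ne_zero.1 hc
  exact ⟨i, (Finset.mem_filter.1 hi).2⟩

lemma emp_prob (F : Set ℤ) (a : ℤ) (L : ℕ) (hL : 1 ≤ L) : IsProbabilityMeasure (emp F a L) := by
  constructor
  rw [emp_apply F a L MeasurableSet.univ]
  simp only [Set.mem_univ, Finset.filter_true, Finset.card_range]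
  exact ENNReal.inv_mul_cancel (by simp; omega) (by simp)

lemma emp_integral (F : Set ℤ) (a : ℤ) (L : ℕ) (f : (ℤ → Bool) → ℝ) (hf : Continuous f) :
    ∫ x, f x ∂(emp F a L) = (L : ℝ)⁻¹ * ∑ i ∈ Finset.range L, f (orb F (a + i)) := by
  rw [emp, integral_finset_sum_measure]
  · rw [Finset.mul_sum]
    refine Finset.sum_congr rfl fun i _ => ?_
    rw [integral_smul_measure, integral_dirac]
    simp
  · intro i hi
    refine Integrable.smul_measure ?_ ?_
    · exact (integrable_dirac (by simp))
    · have : L ≠ 0 := by rintro rfl; simp at hi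
      simp [this]

lemma shiftE_orb (F : Set ℤ) (n : ℤ) : shiftE (orb F n) = orb F (n + 1) := by
  funext k
  change orb F n (k + 1) = _
  simp only [orb]
  congr 2; ring

lemma shiftE_cont : Continuous shiftE := continuous_pi fun k => continuous_apply (k + 1)

lemma backward_dir (d : ℕ) (P : Set ℤ) (h : PoincareRecSet d P) (F : Set ℤ)
    (hF : PosUpperBanachDensity F) :
    ∃ n : Fin d → ℤ, FS n ⊆ P ∧ ∃ a ∈ F, ∀ m ∈ FS n, a + m ∈ F := by
  obtain ⟨δ, hδ, hF⟩ := hF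
  choose a L hNL hL hd using hF
  let ν : ℕ → ProbabilityMeasure (ℤ → Bool) := fun N => ⟨emp F (a N) (L N), emp_prob _ _ _ (hL N)⟩
  obtain ⟨μ, hμ⟩ : ∃ μ, Tendsto ν (hyperfilter ℕ : Filter ℕ) (𝓝 μ) := by
    obtain ⟨μ, -, hμ⟩ := isCompact_univ.ultrafilter_le_nhds ((hyperfilter ℕ).map ν) (by simp)
    exact ⟨μ, hμ⟩
  have hLt : Tendsto (fun N => (L N : ℝ)) (hyperfilter ℕ : Filter ℕ) atTop := by
    refine (tendsto_natCast_atTop_atTop.comp (tendsto_atTop_mono hNL tendsto_id)).mono_left ?_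
    exact Nat.hyperfilter_le_atTop
  have hclopen : ∀ B : Set (ℤ → Bool), IsClopen B →
      Tendsto (fun N => emp F (a N) (L N) B) (hyperfilter ℕ : Filter ℕ)
        (𝓝 ((μ : Measure (ℤ → Bool)) B)) := fun B hB =>
    ProbabilityMeasure.tendsto_measure_of_null_frontier_of_tendsto' hμ (by simp [hB.frontier_eq])
  have hinv : MeasurePreserving (⇑shiftE) (μ : Measure (ℤ → Bool)) μ := by
    refine ⟨shiftE.measurable, ?_⟩
    haveI : IsProbabilityMeasure (Measure.map shiftE (μ : Measure (ℤ → Bool))) :=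
      Measure.isProbabilityMeasure_map shiftE.measurable.aemeasurable
    refine ext_of_forall_integral_eq_of_IsFiniteMeasure fun f => ?_
    rw [integral_map shiftE.measurable.aemeasurable f.continuous.aestronglyMeasurable]
    have ht := ProbabilityMeasure.tendsto_iff_forall_integral_tendsto.1 hμ
    have h1 := ht f
    have h2 := ht (f.compContinuous ⟨shiftE, shiftE_cont⟩)
    have h3 := h2.sub h1
    have h4 : Tendsto (fun N => (∫ ω, (f.compContinuous ⟨shiftE, shiftE_cont⟩) ω ∂(ν N : Measure (ℤ → Bool)))
        - ∫ ω, f ω ∂(ν N : Measure (ℤ → Bool))) (hyperfilter ℕ : Filter ℕ) (𝓝 0) := by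
      have h5 : Tendsto (fun N => (L N : ℝ)⁻¹ * (2 * ‖f‖)) (hyperfilter ℕ : Filter ℕ) (𝓝 0) := by
        simpa using (tendsto_inv_atTop_zero.comp hLt).mul_const (2 * ‖f‖)
      refine squeeze_zero_norm (fun N => ?_) h5
      change ‖(∫ ω, f (shiftE ω) ∂(emp F (a N) (L N))) - ∫ ω, f ω ∂(emp F (a N) (L N))‖ ≤ _
      rw [emp_integral _ _ _ _ f.continuous,
        emp_integral _ _ _ (fun ω => f (shiftE ω)) (f.continuous.comp shiftE_cont), ← mul_sub,
        ← Finset.sum_sub_distrib]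
      have h6 := Finset.sum_range_sub (fun i : ℕ => f (orb F (a N + i))) (L N)
      have h7 : ∀ i : ℕ, f (shiftE (orb F (a N + i))) = f (orb F (a N + (i + 1 : ℕ))) := by
        intro i; rw [shiftE_orb]; push_cast; rw [add_assoc]
      simp only [h7]
      rw [h6, norm_mul, norm_inv, Real.norm_natCast]
      refine mul_le_mul_of_nonneg_left ?_ (by positivity)
      refine (norm_sub_le _ _).trans ?_
      have := f.norm_coe_le_norm (orb F (a N + (L N : ℕ)))
      have := f.norm_coe_le_norm (orb F (a N + ((0 : ℕ) : ℤ)))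
      linarith
    exact sub_eq_zero.1 (tendsto_nhds_unique h3 h4)
  set A : Set (ℤ → Bool) := {x | x 0 = true} with hAdef
  have hcl : ∀ m : ℤ, IsClopen {x : ℤ → Bool | x m = true} := fun m =>
    (isClopen_discrete {true}).preimage (continuous_apply m)
  have hA : IsClopen A := hcl 0
  have hApos : 0 < (μ : Measure (ℤ → Bool)) A := by
    refine lt_of_lt_of_le (ENNReal.ofReal_pos.2 hδ) (ge_of_tendsto' (hclopen A hA) fun N => ?_)
    rw [emp_apply _ _ _ hA.isClosed.measurableSet, mul_comm, ← div_eq_mul_inv,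
      ENNReal.le_div_iff_mul_le (by left; have := hL N; simp; omega) (by simp),
      ← ENNReal.ofReal_natCast, ← ENNReal.ofReal_natCast, ← ENNReal.ofReal_mul hδ.le]
    refine ENNReal.ofReal_le_ofReal ((hd N).trans (Nat.cast_le.2 ?_))
    refine Finset.card_le_card_of_injOn (fun x : ℤ => (x - a N).toNat) ?_ ?_
    · intro x hx
      simp only [Finset.coe_filter, Finset.mem_Icc, Set.mem_setOf_eq] at hx
      obtain ⟨⟨h1, h2⟩, h3⟩ := hx
      have h4 : a N + ((x - a N).toNat : ℤ) = x := by omega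
      simp only [Finset.coe_filter, Finset.mem_range, Set.mem_setOf_eq, h4, hAdef, orb, add_zero,
        decide_eq_true_eq]
      exact ⟨by omega, h3⟩
    · intro x hx y hy hxy
      simp only [Finset.coe_filter, Finset.mem_Icc, Set.mem_setOf_eq] at hx hy hxy
      omega
  obtain ⟨n, hn, hpos⟩ := h (ℤ → Bool) (μ : Measure (ℤ → Bool)) shiftE hinv A
    hA.isClosed.measurableSet hApos
  refine ⟨n, hn, ?_⟩
  set B := A ∩ ⋂ m ∈ FS n, zIter shiftE.toEquiv m ⁻¹' A with hB
  have hpre : ∀ m, zIter shiftE.toEquiv m ⁻¹' A = {x | x m = true} := by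
    intro m; ext x; simp [hAdef, shiftE_iter]
  have hBc : IsClopen B := by
    refine hA.inter ((FS_finite n).isClopen_biInter fun m _ => ?_)
    rw [hpre]; exact hcl m
  obtain ⟨N, hN⟩ := ((hclopen B hBc).eventually (lt_mem_nhds hpos)).exists
  obtain ⟨i, hi⟩ := emp_pos F _ _ hBc.isClosed.measurableSet hN
  refine ⟨a N + i, by simpa [hAdef, orb] using hi.1, fun m hm => ?_⟩
  have := Set.mem_iInter₂.1 hi.2 m hm
  rw [hpre] at this
  simpa [orb] using this

/-- `P` is intersective of order `d` iff it is a Poincaré recurrence set of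
order `d`. -/
theorem statement17 (d : ℕ) (hd : 1 ≤ d) (P : Set ℤ) :
    (∀ F : Set ℤ, PosUpperBanachDensity F →
        ∃ n : Fin d → ℤ, FS n ⊆ P ∧ ∃ a ∈ F, ∀ m ∈ FS n, a + m ∈ F)
      ↔ PoincareRecSet d P :=
  ⟨forward_dir d P, backward_dir d P⟩
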